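/- Let q > 1 be real and c > 0 real. Then for all m, n ∈ ℕ the family (k,σ) ↦ h̃_m(σ√c q^{−2k}) h̃_n(σ√c q^{−2k}) q^{−2k} / (−c q^{−4k};q^{−4})_∞, indexed by k ∈ ℤ and σ ∈ {+1,−1}, is summable, and ∑_{k∈ℤ} ∑_{σ=±1} h̃_m(σ√c q^{−2k}) h̃_n(σ√c q^{−2k}) q^{−2k} / (−c q^{−4k};q^{−4})_∞ = 2 δ_{mn} q^{2m²} (q^{−2};q^{−2})_m · [(q^{−4};q^{−4})_∞ (−c q^{−2};q^{−4})_∞ (−c^{−1} q^{−2};q^{−4})_∞] / [(q^{−2};q^{−4})_∞ (−c;q^{−4})_∞ (−c^{−1} q^{−4};q^{−4})_∞]. This is the orthogonality relation of the q-Hermite II polynomials on the q-lattice {±√c q^{−2k} : k ∈ ℤ}. -/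

import Mathlib

open scoped BigOperators

/-- The q-shifted factorial `(a;p)_n = ∏_{i=0}^{n-1} (1 - a p^i)`. -/
noncomputable def qPoch (a p : ℂ) (n : ℕ) : ℂ :=
  ∏ i ∈ Finset.range n, (1 - a * p ^ i)

/-- The infinite q-shifted factorial `(a;p)_∞ = ∏_{i=0}^∞ (1 - a p^i)`. -/
noncomputable def qPochInf (a p : ℂ) : ℂ :=
  ∏' i : ℕ, (1 - a * p ^ i)

/-- The basic hypergeometric series
`₂φ₁(a,b;0;p,z) = ∑_{j=0}^∞ ((a;p)_j (b;p)_j / (p;p)_j) z^j`. -/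
noncomputable def phi21 (a b p z : ℂ) : ℂ :=
  ∑' j : ℕ, qPoch a p j * qPoch b p j / qPoch p p j * z ^ j

/-- The q-Hermite II type polynomial
`h̃_m(x) = x^m ₂φ₁(q^{2m-2}, q^{2m}; 0; q⁻⁴, -q⁻⁴/x²)`. -/
noncomputable def qHermiteII (q : ℝ) (m : ℕ) (x : ℂ) : ℂ :=
  x ^ m * phi21 ((q : ℂ) ^ (2 * (m : ℤ) - 2)) ((q : ℂ) ^ (2 * (m : ℤ)))
    ((q : ℂ) ^ (-4 : ℤ)) (-(q : ℂ) ^ (-4 : ℤ) / x ^ 2)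

open Filter Topology

section QPochhammer

variable {a p : ℂ}

theorem summable_norm_mul_pow (a : ℂ) (hp : ‖p‖ < 1) :
    Summable fun i : ℕ => ‖-(a * p ^ i)‖ := by
  simpa [norm_mul, norm_pow] using
    (summable_geometric_of_lt_one (norm_nonneg p) hp).mul_left ‖a‖

theorem multipliable_qPochInf (a : ℂ) (hp : ‖p‖ < 1) :
    Multipliable fun i : ℕ => 1 - a * p ^ i := by
  simpa [sub_eq_add_neg] using multipliable_one_add_of_summable (summable_norm_mul_pow a hp)

theorem tendsto_qPoch (a : ℂ) (hp : ‖p‖ < 1) :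
    Tendsto (qPoch a p) atTop (𝓝 (qPochInf a p)) :=
  (multipliable_qPochInf a hp).tendsto_prod_tprod_nat

theorem qPochInf_ne_zero (hp : ‖p‖ < 1) (h : ∀ i : ℕ, 1 - a * p ^ i ≠ 0) :
    qPochInf a p ≠ 0 := by
  simpa [qPochInf, sub_eq_add_neg] using
    tprod_one_add_ne_zero_of_summable (f := fun i : ℕ => -(a * p ^ i))
      (by simpa [sub_eq_add_neg] using h) (summable_norm_mul_pow a hp)

theorem qPoch_zero (a p : ℂ) : qPoch a p 0 = 1 := by simp [qPoch]

theorem qPoch_succ (a p : ℂ) (n : ℕ) :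
    qPoch a p (n + 1) = qPoch a p n * (1 - a * p ^ n) := by
  simp [qPoch, Finset.prod_range_succ]

theorem qPoch_succ' (a p : ℂ) (n : ℕ) :
    qPoch a p (n + 1) = (1 - a) * qPoch (a * p) p n := by
  rw [qPoch, Finset.prod_range_succ', mul_comm, qPoch]
  simp [pow_succ', mul_assoc]

theorem qPoch_ne_zero (h : ∀ i : ℕ, 1 - a * p ^ i ≠ 0) (n : ℕ) : qPoch a p n ≠ 0 :=
  Finset.prod_ne_zero_iff.mpr fun i _ => h i

theorem qPochInf_eq_mul (a : ℂ) (hp : ‖p‖ < 1) :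
    qPochInf a p = (1 - a) * qPochInf (a * p) p := by
  have h := (multipliable_qPochInf (a * p) hp)
  rw [qPochInf, tprod_eq_zero_mul' (by simpa [pow_succ', mul_assoc] using h), qPochInf]
  simp [pow_succ', mul_assoc]

theorem qPochInf_eq_qPoch_mul (a : ℂ) (hp : ‖p‖ < 1) (n : ℕ) :
    qPochInf a p = qPoch a p n * qPochInf (a * p ^ n) p := by
  induction n with
  | zero => simp [qPoch]
  | succ n ih => rw [ih, qPochInf_eq_mul _ hp, qPoch_succ, pow_succ]; ring_nf

theorem one_sub_self_mul_pow_ne_zero (hp : ‖p‖ < 1) (i : ℕ) : 1 - p * p ^ i ≠ 0 := by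
  intro h
  have h1 : ‖p ^ (i + 1)‖ = 1 := by
    rw [pow_succ', ← sub_eq_zero.mp h, norm_one]
  rw [norm_pow] at h1
  exact (pow_lt_one₀ (norm_nonneg p) hp (Nat.succ_ne_zero i)).ne h1

end QPochhammer

section QBinomial

variable {p : ℂ}

theorem exists_norm_qPoch_div_le (A : ℂ) (hp : ‖p‖ < 1) :
    ∃ K, ∀ n, ‖qPoch A p n / qPoch p p n‖ ≤ K := by
  have h := (tendsto_qPoch A hp).div (tendsto_qPoch p hp)
    (qPochInf_ne_zero hp (one_sub_self_mul_pow_ne_zero hp))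
  obtain ⟨K, hK⟩ := (Metric.isBounded_range_of_tendsto _ h).exists_norm_le
  exact ⟨K, fun n => hK _ ⟨n, rfl⟩⟩

theorem summable_qBinomial (A : ℂ) (hp : ‖p‖ < 1) {z : ℂ} (hz : ‖z‖ < 1) :
    Summable fun k : ℕ => qPoch A p k / qPoch p p k * z ^ k := by
  obtain ⟨K, hK⟩ := exists_norm_qPoch_div_le A hp
  refine Summable.of_norm_bounded
    ((summable_geometric_of_lt_one (norm_nonneg z) hz).mul_left K) fun k => ?_
  rw [norm_mul, norm_pow]
  exact mul_le_mul_of_nonneg_right (hK k) (by positivity)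

theorem qBinomial_functional_equation (A : ℂ) (hp : ‖p‖ < 1) {z : ℂ} (hz : ‖z‖ < 1) :
    (1 - z) * ∑' k : ℕ, qPoch A p k / qPoch p p k * z ^ k =
      (1 - A * z) * ∑' k : ℕ, qPoch A p k / qPoch p p k * (z * p) ^ k := by
  have hzp : ‖z * p‖ < 1 := by
    rw [norm_mul]; exact mul_lt_one_of_nonneg_of_lt_one_left (norm_nonneg _) hz hp.le
  have s1 := summable_qBinomial A hp hz
  have s2 := summable_qBinomial A hp hzp
  have e : ∑' k : ℕ, (qPoch A p (k + 1) / qPoch p p (k + 1) * z ^ (k + 1) -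
        qPoch A p (k + 1) / qPoch p p (k + 1) * (z * p) ^ (k + 1)) =
      ∑' k : ℕ, (z * (qPoch A p k / qPoch p p k * z ^ k) -
        A * z * (qPoch A p k / qPoch p p k * (z * p) ^ k)) := by
    refine tsum_congr fun k => ?_
    have h1 := qPoch_ne_zero (one_sub_self_mul_pow_ne_zero hp) k
    have h2 := one_sub_self_mul_pow_ne_zero hp k
    rw [qPoch_succ, qPoch_succ, mul_pow, mul_pow]
    generalize hx : p ^ k = x at h2 ⊢
    have h3 : 1 - x * p ≠ 0 := by rwa [mul_comm]
    rw [pow_succ p k, hx]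
    field_simp
    ring
  rw [((summable_nat_add_iff 1).mpr s1).tsum_sub ((summable_nat_add_iff 1).mpr s2),
    (s1.mul_left z).tsum_sub (s2.mul_left (A * z)), tsum_mul_left, tsum_mul_left] at e
  have t1 := s1.tsum_eq_zero_add
  have t2 := s2.tsum_eq_zero_add
  simp only [qPoch_zero, pow_zero] at t1 t2
  linear_combination e + t1 - t2

/-- The q-binomial theorem. -/
theorem tsum_qBinomial (A : ℂ) (hp : ‖p‖ < 1) {z : ℂ} (hz : ‖z‖ < 1) :
    (∑' k : ℕ, qPoch A p k / qPoch p p k * z ^ k) * qPochInf z p = qPochInf (A * z) p := by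
  have hzp (n : ℕ) : ‖z * p ^ n‖ ≤ ‖z‖ := by
    rw [norm_mul, norm_pow]
    exact mul_le_of_le_one_right (norm_nonneg _) (pow_le_one₀ (norm_nonneg _) hp.le)
  have h (n : ℕ) : (∑' k : ℕ, qPoch A p k / qPoch p p k * z ^ k) * qPoch z p n =
      qPoch (A * z) p n * ∑' k : ℕ, qPoch A p k / qPoch p p k * (z * p ^ n) ^ k := by
    induction n with
    | zero => simp [qPoch]
    | succ n ih =>
      rw [qPoch_succ, qPoch_succ, ← mul_assoc, ih, mul_right_comm, mul_assoc, mul_assoc,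
        
        qBinomial_functional_equation A hp ((hzp n).trans_lt hz), pow_succ]
      ring_nf
  have lim : Tendsto (fun n : ℕ => ∑' k : ℕ, qPoch A p k / qPoch p p k * (z * p ^ n) ^ k)
      atTop (𝓝 (∑' k : ℕ, if k = 0 then 1 else 0)) := by
    obtain ⟨K, hK⟩ := exists_norm_qPoch_div_le A hp
    refine tendsto_tsum_of_dominated_convergence
      ((summable_geometric_of_lt_one (norm_nonneg z) hz).mul_left K) (fun k => ?_)
      (Eventually.of_forall fun n k => ?_)
    · rcases eq_or_ne k 0 with rfl | hk
      · simp [qPoch]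
      · have := (((tendsto_pow_atTop_nhds_zero_of_norm_lt_one hp).const_mul z).pow k).const_mul
          (qPoch A p k / qPoch p p k)
        simpa [hk] using this
    · rw [norm_mul, norm_pow]
      exact mul_le_mul (hK k) (pow_le_pow_left₀ (norm_nonneg _) (hzp n) k) (by positivity)
        ((norm_nonneg _).trans (hK k))
  rw [tsum_ite_eq] at lim
  have l1 := (tendsto_qPoch z hp).const_mul (∑' k : ℕ, qPoch A p k / qPoch p p k * z ^ k)
  have l2 := (tendsto_qPoch (A * z) hp).mul lim
  rw [mul_one] at l2
  exact tendsto_nhds_unique (l1.congr h) l2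

end QBinomial

section BilateralSum

variable {a p : ℂ}

theorem qPochInf_mul_zpow_ne_zero (hp : ‖p‖ < 1) (hp0 : p ≠ 0)
    (h : ∀ k : ℤ, 1 - a * p ^ k ≠ 0) (k : ℤ) : qPochInf (a * p ^ k) p ≠ 0 := by
  refine qPochInf_ne_zero hp fun i => ?_
  have := h (k + i)
  rwa [zpow_add₀ hp0, zpow_natCast, ← mul_assoc] at this

theorem qPochInf_mul_zpow_succ (hp : ‖p‖ < 1) (hp0 : p ≠ 0) (k : ℤ) :
    qPochInf (a * p ^ k) p = (1 - a * p ^ k) * qPochInf (a * p ^ (k + 1)) p := by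
  rw [qPochInf_eq_mul _ hp, zpow_add_one₀ hp0, mul_assoc]

theorem summable_zpow_div_qPochInf (hp : ‖p‖ < 1) (hp0 : p ≠ 0) (ha : a ≠ 0)
    (h : ∀ k : ℤ, 1 - a * p ^ k ≠ 0) {z : ℂ} (hz : ‖z‖ < 1) (hz0 : z ≠ 0) :
    Summable fun k : ℤ => z ^ k / qPochInf (a * p ^ k) p := by
  have hne (k : ℤ) : z ^ k / qPochInf (a * p ^ k) p ≠ 0 :=
    div_ne_zero (zpow_ne_zero _ hz0) (qPochInf_mul_zpow_ne_zero hp hp0 h k)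
  have hs (k : ℤ) : z ^ (k + 1) / qPochInf (a * p ^ (k + 1)) p =
      z * (1 - a * p ^ k) * (z ^ k / qPochInf (a * p ^ k) p) := by
    have h1 := qPochInf_mul_zpow_ne_zero hp hp0 h (k + 1)
    have h2 := h k
    rw [qPochInf_mul_zpow_succ hp hp0 k, zpow_add_one₀ hz0]
    field_simp
  have hpl := tendsto_pow_atTop_nhds_zero_of_norm_lt_one hp
  refine Summable.of_nat_of_neg ?_ ?_
  · refine summable_of_ratio_test_tendsto_lt_one hz (Eventually.of_forall fun n => hne n) ?_
    have : Tendsto (fun n : ℕ => ‖z * (1 - a * p ^ n)‖) atTop (𝓝 ‖z * (1 - a * 0)‖) :=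
      ((hpl.const_mul a).const_sub 1).const_mul z |>.norm
    rw [mul_zero, sub_zero, mul_one] at this
    refine this.congr fun n => ?_
    rw [Nat.cast_succ, hs, norm_mul _ (_ / _), mul_div_cancel_right₀ _ (norm_ne_zero_iff.mpr (hne n)),
      zpow_natCast]
  · refine summable_of_ratio_test_tendsto_lt_one zero_lt_one
      (Eventually.of_forall fun n => hne _) ?_
    have : Tendsto (fun n : ℕ => ‖p ^ (n + 1) / (z * (p ^ (n + 1) - a))‖) atTop
        (𝓝 ‖0 / (z * (0 - a))‖) := by
      have hpl' := (tendsto_add_atTop_iff_nat 1).mpr hpl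
      exact (hpl'.div ((hpl'.sub_const a).const_mul z) (by simp [hz0, ha])).norm
    rw [zero_div, norm_zero] at this
    refine this.congr fun n => ?_
    have e := hs (-((n + 1 : ℕ) : ℤ))
    have h2 := h (-((n + 1 : ℕ) : ℤ))
    rw [show -((n + 1 : ℕ) : ℤ) + 1 = -(n : ℤ) by push_cast; ring] at e
    rw [e, norm_mul, div_mul_cancel_right₀ (norm_ne_zero_iff.mpr (hne _)), ← norm_inv]
    congr 1
    rw [zpow_neg, zpow_natCast] at h2 ⊢
    have h3 : p ^ (n + 1) ≠ 0 := pow_ne_zero _ hp0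
    have h4 : p ^ (n + 1) - a ≠ 0 := by
      contrapose! h2
      rw [← sub_eq_zero.mp h2, mul_inv_cancel₀ h3, sub_self]
    field_simp

theorem qPochInf_shift_ratio (hp : ‖p‖ < 1) (hp0 : p ≠ 0) (ha : a ≠ 0)
    {z : ℂ} (hz0 : z ≠ 0) (N : ℕ) :
    z ^ (-(N : ℤ)) * qPochInf (a * p ^ (-(N : ℤ)) * z) p * qPochInf a p * qPoch (p / a) p N =
      qPochInf (a * p ^ (-(N : ℤ))) p * qPochInf (a * z) p * qPoch (p / (a * z)) p N := by
  induction N with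
  | zero => simp [qPoch]; ring
  | succ N ih =>
    have e1 := qPochInf_mul_zpow_succ (a := a) hp hp0 (-((N + 1 : ℕ) : ℤ))
    have e2 := qPochInf_mul_zpow_succ (a := a * z) hp hp0 (-((N + 1 : ℕ) : ℤ))
    rw [show -((N + 1 : ℕ) : ℤ) + 1 = -(N : ℤ) by push_cast; ring] at e1 e2
    rw [mul_right_comm a _ z] at ih ⊢
    rw [e1, qPoch_succ, qPoch_succ, e2]
    have h3 : z ^ (-((N + 1 : ℕ) : ℤ)) = z ^ (-(N : ℤ)) * z⁻¹ := by
      rw [← zpow_sub_one₀ hz0]; congr 1; push_cast; ring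
    have h4 : p ^ (-((N + 1 : ℕ) : ℤ)) = (p ^ (N + 1))⁻¹ := by rw [zpow_neg, zpow_natCast]
    rw [h3, h4]
    have h5 : p ^ N ≠ 0 := pow_ne_zero _ hp0
    have k1 : z⁻¹ * (1 - a * z * (p ^ (N + 1))⁻¹) * (1 - p / a * p ^ N) =
        (1 - a * (p ^ (N + 1))⁻¹) * (1 - p / (a * z) * p ^ N) := by
      field_simp
      ring
    linear_combination (z⁻¹ * (1 - a * z * (p ^ (N + 1))⁻¹) * (1 - p / a * p ^ N)) * ih +
      qPochInf (a * p ^ (-(N : ℤ))) p * qPochInf (a * z) p * qPoch (p / (a * z)) p N * k1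

theorem one_sub_div_mul_pow_ne_zero (hp0 : p ≠ 0) (ha : a ≠ 0)
    (h : ∀ k : ℤ, 1 - a * p ^ k ≠ 0) (i : ℕ) : 1 - p / a * p ^ i ≠ 0 := by
  have h1 := h (-((i + 1 : ℕ) : ℤ))
  rw [zpow_neg, zpow_natCast] at h1
  contrapose! h1
  have : a = p ^ (i + 1) := by
    field_simp at h1
    linear_combination h1
  rw [this, mul_inv_cancel₀ (pow_ne_zero _ hp0), sub_self]

/-- Ramanujan's `₁ψ₁` summation in the case of vanishing denominator parameter. -/
theorem tsum_zpow_div_qPochInf (hp : ‖p‖ < 1) (hp0 : p ≠ 0) (ha : a ≠ 0)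
    (h : ∀ k : ℤ, 1 - a * p ^ k ≠ 0) {z : ℂ} (hz : ‖z‖ < 1) (hz0 : z ≠ 0) :
    ∑' k : ℤ, z ^ k / qPochInf (a * p ^ k) p =
      qPochInf p p * qPochInf (a * z) p * qPochInf (p / (a * z)) p /
        (qPochInf z p * qPochInf a p * qPochInf (p / a) p) := by
  have hpp := qPochInf_ne_zero hp (one_sub_self_mul_pow_ne_zero hp)
  have hzz : qPochInf z p ≠ 0 := by
    refine qPochInf_ne_zero hp fun i hi => ?_
    have h1 : ‖z * p ^ i‖ = 1 := by rw [← sub_eq_zero.mp hi, norm_one]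
    rw [norm_mul, norm_pow] at h1
    exact (mul_lt_one_of_nonneg_of_lt_one_left (norm_nonneg _) hz
      (pow_le_one₀ (norm_nonneg _) hp.le)).ne h1
  have hu := qPochInf_mul_zpow_ne_zero hp hp0 h
  have haa : qPochInf a p ≠ 0 := by simpa using hu 0
  have hpa (N : ℕ) := qPoch_ne_zero (one_sub_div_mul_pow_ne_zero hp0 ha h) N
  have hpai := qPochInf_ne_zero hp (one_sub_div_mul_pow_ne_zero hp0 ha h)
  have hs := summable_zpow_div_qPochInf hp hp0 ha h hz hz0
  set r : ℤ → ℂ := fun j => if 0 ≤ j then (qPoch p p j.toNat)⁻¹ else 0 with hr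
  have hr_lim : Tendsto (fun n : ℕ => (qPoch p p n)⁻¹) atTop (𝓝 (qPochInf p p)⁻¹) :=
    (tendsto_qPoch p hp).inv₀ hpp
  have hN (N : ℕ) : ∑' l : ℤ, z ^ l / qPochInf (a * p ^ l) p * r (l + N) =
      qPochInf (a * z) p * qPoch (p / (a * z)) p N /
        (qPochInf a p * qPoch (p / a) p N * qPochInf z p) := by
    have hinj : Function.Injective fun k : ℕ => (k : ℤ) - N := fun x y hxy => by
      simpa using hxy
    rw [← hinj.tsum_eq]
    · have e (k : ℕ) : z ^ ((k : ℤ) - N) / qPochInf (a * p ^ ((k : ℤ) - N)) p *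
          r ((k : ℤ) - N + N) = z ^ (-(N : ℤ)) / qPochInf (a * p ^ (-(N : ℤ))) p *
            (qPoch (a * p ^ (-(N : ℤ))) p k / qPoch p p k * z ^ k) := by
        have h1 := qPochInf_eq_qPoch_mul (a * p ^ (-(N : ℤ))) hp k
        rw [mul_assoc a, ← zpow_natCast p k, ← zpow_add₀ hp0, neg_add_eq_sub] at h1
        have h2 := hu (-(N : ℤ))
        have h3 := hu ((k : ℤ) - N)
        have h4 := qPoch_ne_zero (one_sub_self_mul_pow_ne_zero hp) k
        have h5 : qPoch (a * p ^ (-(N : ℤ))) p k ≠ 0 := fun h0 => h2 (by rw [h1, h0, zero_mul])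
        rw [h1, sub_add_cancel, hr, sub_eq_neg_add, zpow_add₀ hz0, zpow_natCast,
          ← sub_eq_neg_add]
        simp only [Nat.cast_nonneg, if_true, Int.toNat_natCast]
        field_simp
      rw [tsum_congr e, tsum_mul_left]
      have h1 := tsum_qBinomial (a * p ^ (-(N : ℤ))) hp hz
      have h2 := qPochInf_shift_ratio hp hp0 ha hz0 N
      have h3 := hu (-(N : ℤ))
      have h4 := hpa N
      rw [← h1] at h2
      rw [eq_div_iff (mul_ne_zero (mul_ne_zero haa h4) hzz), div_mul_eq_mul_div,
        div_mul_eq_mul_div, div_eq_iff h3]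
      linear_combination h2
    · intro l hl
      refine ⟨(l + N).toNat, ?_⟩
      have : 0 ≤ l + N := by
        by_contra hneg
        exact hl (by simp [hr, hneg])
      simp [Int.toNat_of_nonneg this]
  obtain ⟨K, hK⟩ := (Metric.isBounded_range_of_tendsto _ hr_lim).exists_norm_le
  have hrK (j : ℤ) : ‖r j‖ ≤ K := by
    by_cases hj : 0 ≤ j
    · simpa [hr, hj] using hK _ ⟨j.toNat, rfl⟩
    · simpa [hr, hj] using (norm_nonneg _).trans (hK _ ⟨0, rfl⟩)
  have l1 : Tendsto (fun N : ℕ => ∑' l : ℤ, z ^ l / qPochInf (a * p ^ l) p * r (l + N)) atTop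
      (𝓝 (∑' l : ℤ, z ^ l / qPochInf (a * p ^ l) p * (qPochInf p p)⁻¹)) := by
    refine tendsto_tsum_of_dominated_convergence (hs.norm.mul_right K) (fun l => ?_)
      (Eventually.of_forall fun N l => ?_)
    · refine Tendsto.const_mul _ ?_
      rw [← tendsto_add_atTop_iff_nat l.natAbs]
      refine ((tendsto_add_atTop_iff_nat (l + l.natAbs).toNat).mpr hr_lim).congr fun n => ?_
      have h1 : 0 ≤ l + (n + l.natAbs : ℕ) := by omega
      have h2 : (l + (n + l.natAbs : ℕ)).toNat = n + (l + l.natAbs).toNat := by omega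
      simp only [hr, h1, if_true, h2]
    · rw [norm_mul]
      exact mul_le_mul_of_nonneg_left (hrK _) (norm_nonneg _)
  have l2 := ((tendsto_qPoch (p / (a * z)) hp).const_mul (qPochInf (a * z) p)).div
    (((tendsto_qPoch (p / a) hp).const_mul (qPochInf a p)).mul_const (qPochInf z p))
    (mul_ne_zero (mul_ne_zero haa hpai) hzz)
  have := tendsto_nhds_unique (l1.congr hN) l2
  rw [tsum_mul_right, mul_inv_eq_iff_eq_mul₀ hpp] at this
  rw [this]
  ring

end BilateralSum

section HermitePolynomial

open Polynomial

/-- The coefficient of `x^{n-2j}` in the `n`-th discrete `p`-Hermite II polynomial, as a function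
of `y = p^{-n}`. -/
noncomputable def hermiteIICoeff (p y : ℂ) (j : ℕ) : ℂ :=
  qPoch (y * p) (p ^ 2) j * qPoch y (p ^ 2) j / qPoch (p ^ 2) (p ^ 2) j * (-p ^ 2) ^ j

/-- The discrete `p`-Hermite II polynomial of degree `n`. -/
noncomputable def hermiteIIPoly (p : ℂ) (n : ℕ) : ℂ[X] :=
  ∑ j ∈ Finset.range (n + 1), C (hermiteIICoeff p (p ^ (-(n : ℤ))) j) * X ^ (n - 2 * j)

variable {p : ℂ}

theorem norm_sq_lt_one (hp : ‖p‖ < 1) : ‖p ^ 2‖ < 1 := by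
  rw [norm_pow]
  exact pow_lt_one₀ (norm_nonneg p) hp two_ne_zero

theorem hermiteIICoeff_zero (p y : ℂ) : hermiteIICoeff p y 0 = 1 := by
  simp [hermiteIICoeff, qPoch]

theorem hermiteIICoeff_raise (hp : ‖p‖ < 1) (hp0 : p ≠ 0) (y : ℂ) (j : ℕ) :
    hermiteIICoeff p (y / p) (j + 1) =
      ((p ^ 2) ^ (j + 1))⁻¹ * hermiteIICoeff p y (j + 1) +
        (((p ^ 2) ^ j)⁻¹ - y) * hermiteIICoeff p y j := by
  have h1 := qPoch_ne_zero (one_sub_self_mul_pow_ne_zero (norm_sq_lt_one hp)) j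
  have h2 := one_sub_self_mul_pow_ne_zero (norm_sq_lt_one hp) j
  have e : y / p * p ^ 2 = y * p := by field_simp
  simp only [hermiteIICoeff]
  rw [div_mul_cancel₀ y hp0, qPoch_succ' (y / p), e, qPoch_succ, qPoch_succ, qPoch_succ]
  have h3 : (p ^ 2) ^ j ≠ 0 := by positivity
  rw [pow_succ (-p ^ 2), pow_succ (p ^ 2) j]
  generalize (p ^ 2) ^ j = x at *
  generalize (-p ^ 2) ^ j = u at *
  have h4 : 1 - x * p ^ 2 ≠ 0 := by rwa [mul_comm]
  field_simp
  ring

theorem hermiteIICoeff_lower (hp0 : p ≠ 0) (y : ℂ) (j : ℕ) :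
    hermiteIICoeff p (y / p) j * (y / p * (p ^ 2) ^ j - 1) =
      (y / p - 1) * hermiteIICoeff p y j := by
  have h := (qPoch_succ (y / p) (p ^ 2) j).symm.trans (qPoch_succ' (y / p) (p ^ 2) j)
  rw [show y / p * p ^ 2 = y * p by field_simp] at h
  simp only [hermiteIICoeff]
  rw [div_mul_cancel₀ y hp0]
  linear_combination (-(qPoch y (p ^ 2) j / qPoch (p ^ 2) (p ^ 2) j * (-p ^ 2) ^ j)) * h

theorem hermiteIICoeff_eq_zero (hp0 : p ≠ 0) {n j : ℕ} (h : n < 2 * j) :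
    hermiteIICoeff p (p ^ (-(n : ℤ))) j = 0 := by
  have hz (a : ℂ) (i : ℕ) (hi : i < j) (ha : a * (p ^ 2) ^ i = 1) : qPoch a (p ^ 2) j = 0 :=
    Finset.prod_eq_zero (Finset.mem_range.mpr hi) (by rw [ha, sub_self])
  obtain ⟨i, rfl | rfl⟩ := Nat.even_or_odd' n
  · rw [hermiteIICoeff, hz (p ^ (-((2 * i : ℕ) : ℤ))) i (by omega)]
    · simp
    · rw [zpow_neg, zpow_natCast, pow_mul, inv_mul_cancel₀ (by positivity)]
  · rw [hermiteIICoeff, hz (p ^ (-((2 * i + 1 : ℕ) : ℤ)) * p) i (by omega)]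
    · simp
    · rw [zpow_neg, zpow_natCast, pow_succ, pow_mul]
      field_simp

theorem eval_hermiteIIPoly (hp0 : p ≠ 0) {n N : ℕ} (hN : n < N) (x : ℂ) :
    (hermiteIIPoly p n).eval x =
      ∑ j ∈ Finset.range N, hermiteIICoeff p (p ^ (-(n : ℤ))) j * x ^ ((n : ℤ) - 2 * j) := by
  rw [hermiteIIPoly, eval_finsetSum]
  rw [← Finset.sum_subset (Finset.range_mono hN) fun j _ hj => by
    rw [hermiteIICoeff_eq_zero hp0 (by simp at hj; omega), zero_mul]]
  refine Finset.sum_congr rfl fun j _ => ?_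
  rcases lt_or_ge n (2 * j) with h | h
  · rw [hermiteIICoeff_eq_zero hp0 h]
    simp
  · rw [eval_mul, eval_C, eval_pow, eval_X, ← zpow_natCast, Nat.cast_sub h]
    push_cast
    rfl

theorem zpow_neg_succ_eq_div (hp0 : p ≠ 0) (n : ℕ) :
    p ^ (-((n + 1 : ℕ) : ℤ)) = p ^ (-(n : ℤ)) / p := by
  rw [div_eq_mul_inv, ← zpow_sub_one₀ hp0]
  congr 1
  push_cast
  ring

theorem hermiteIIPoly_zero (p : ℂ) : hermiteIIPoly p 0 = 1 := by
  simp [hermiteIIPoly, hermiteIICoeff_zero]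

/-- The backward shift (raising) relation. -/
theorem hermiteIIPoly_raise (hp : ‖p‖ < 1) (hp0 : p ≠ 0) (n : ℕ) {x : ℂ} (hx : x ≠ 0) :
    x * (hermiteIIPoly p (n + 1)).eval x =
      p ^ (-(n : ℤ)) * ((1 + x ^ 2) * (hermiteIIPoly p n).eval (p * x) -
        (hermiteIIPoly p n).eval x) := by
  have hpx : p * x ≠ 0 := mul_ne_zero hp0 hx
  have e1 := eval_hermiteIIPoly hp0 (show n + 1 < n + 1 + 1 by omega) x
  have e2 := eval_hermiteIIPoly hp0 (show n < n + 1 + 1 by omega) (p * x)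
  have e3 := eval_hermiteIIPoly hp0 (show n < n + 1 by omega) (p * x)
  have e4 := eval_hermiteIIPoly hp0 (show n < n + 1 by omega) x
  rw [Finset.sum_range_succ'] at e1 e2
  have split : (1 + x ^ 2) * (hermiteIIPoly p n).eval (p * x) - (hermiteIIPoly p n).eval x =
      x ^ 2 * (hermiteIIPoly p n).eval (p * x) +
        ((hermiteIIPoly p n).eval (p * x) - (hermiteIIPoly p n).eval x) := by ring
  rw [split, e1, mul_add]
  nth_rewrite 1 [e2]
  rw [e3, e4, ← Finset.sum_sub_distrib]
  simp only [mul_add, Finset.mul_sum]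
  rw [add_right_comm, ← Finset.sum_add_distrib]
  congr 1
  · refine Finset.sum_congr rfl fun j _ => ?_
    have h1 : x ^ (((n + 1 : ℕ) : ℤ) - 2 * ((j + 1 : ℕ) : ℤ)) = x ^ ((n : ℤ) - 2 * j) / x := by
      rw [div_eq_mul_inv, ← zpow_sub_one₀ hx]; congr 1; push_cast; ring
    have h2 (t : ℂ) (ht : t ≠ 0) :
        t ^ ((n : ℤ) - 2 * ((j + 1 : ℕ) : ℤ)) = t ^ ((n : ℤ) - 2 * j) / t ^ 2 := by
      rw [← zpow_natCast t 2, ← zpow_sub₀ ht]; congr 1; push_cast; ring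
    have h3 : p ^ ((n : ℤ) - 2 * j) = (p ^ (-(n : ℤ)))⁻¹ * ((p ^ 2) ^ j)⁻¹ := by
      rw [zpow_sub₀ hp0, zpow_neg, inv_inv, zpow_mul]; norm_cast
    have hy : p ^ (-(n : ℤ)) ≠ 0 := zpow_ne_zero _ hp0
    have hP : (p ^ 2) ^ j ≠ 0 := by positivity
    rw [zpow_neg_succ_eq_div hp0, hermiteIICoeff_raise hp hp0, h1, h2 _ hpx, mul_zpow, h3]
    rw [pow_succ (p ^ 2) j]
    field_simp
  · simp only [hermiteIICoeff_zero, Nat.cast_zero, mul_zero, sub_zero, one_mul]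
    rw [mul_zpow, zpow_neg, zpow_natCast, zpow_natCast, zpow_natCast]
    field_simp
    ring

/-- The forward shift (lowering) relation. -/
theorem hermiteIIPoly_lower (hp0 : p ≠ 0) (n : ℕ) {x : ℂ} (hx : x ≠ 0) :
    (hermiteIIPoly p (n + 1)).eval (x / p) - (hermiteIIPoly p (n + 1)).eval x =
      (p ^ (-((n + 1 : ℕ) : ℤ)) - 1) * (x * (hermiteIIPoly p n).eval x) := by
  rw [eval_hermiteIIPoly hp0 (show n + 1 < n + 1 + 1 by omega) x,
    eval_hermiteIIPoly hp0 (show n + 1 < n + 1 + 1 by omega) (x / p),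
    eval_hermiteIIPoly hp0 (show n < n + 1 + 1 by omega) x,
    ← Finset.sum_sub_distrib, Finset.mul_sum, Finset.mul_sum]
  refine Finset.sum_congr rfl fun j _ => ?_
  have h := hermiteIICoeff_lower hp0 (p ^ (-(n : ℤ))) j
  have h1 : x ^ (((n + 1 : ℕ) : ℤ) - 2 * j) = x * x ^ ((n : ℤ) - 2 * j) := by
    rw [← zpow_one_add₀ hx]; congr 1; push_cast; ring
  have h2 : (x / p) ^ (((n + 1 : ℕ) : ℤ) - 2 * j) =
      p ^ (-((n + 1 : ℕ) : ℤ)) * (p ^ 2) ^ j * (x * x ^ ((n : ℤ) - 2 * j)) := by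
    rw [div_zpow, h1, div_eq_inv_mul, ← zpow_neg, neg_sub, sub_eq_neg_add, zpow_add₀ hp0, zpow_mul]
    norm_cast
  rw [h1, h2, zpow_neg_succ_eq_div hp0]
  linear_combination (x * x ^ ((n : ℤ) - 2 * j)) * h

end HermitePolynomial

section Orthogonality

open Polynomial

/-- The `k`-th term, combining both signs, of the discrete `p`-Hermite II functional applied to
`Q` on the lattice `{±s p^k}`. -/
noncomputable def hermiteIITerm (p s : ℂ) (Q : ℂ[X]) (k : ℤ) : ℂ :=
  p ^ k * (Q.eval (s * p ^ k) + Q.eval (-(s * p ^ k))) / qPochInf (-s ^ 2 * (p ^ 2) ^ k) (p ^ 2)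

variable {p s : ℂ}

theorem summable_zpow_mul_eval (hp : ‖p‖ < 1) (hp0 : p ≠ 0) (hs0 : s ≠ 0)
    (h : ∀ k : ℤ, 1 - -s ^ 2 * (p ^ 2) ^ k ≠ 0) (Q : ℂ[X]) (t : ℂ) :
    Summable fun k : ℤ =>
      p ^ k * Q.eval (t * p ^ k) / qPochInf (-s ^ 2 * (p ^ 2) ^ k) (p ^ 2) := by
  induction Q using Polynomial.induction_on' with
  | add P Q hP hQ => simpa only [eval_add, mul_add, add_div] using hP.add hQ
  | monomial n b =>
    have hz : ‖p ^ (n + 1)‖ < 1 := by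
      rw [norm_pow]; exact pow_lt_one₀ (norm_nonneg _) hp (Nat.succ_ne_zero n)
    refine ((summable_zpow_div_qPochInf (norm_sq_lt_one hp) (pow_ne_zero 2 hp0)
      (neg_ne_zero.mpr (pow_ne_zero 2 hs0)) h hz (pow_ne_zero _ hp0)).mul_left
        (b * t ^ n)).congr fun k => ?_
    rw [eval_monomial, mul_pow, ← zpow_natCast p (n + 1), ← zpow_mul, ← zpow_natCast (p ^ k),
      ← zpow_mul, mul_comm ((n + 1 : ℕ) : ℤ) k, Nat.cast_succ, mul_add_one, zpow_add₀ hp0]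
    ring

theorem summable_hermiteIITerm (hp : ‖p‖ < 1) (hp0 : p ≠ 0) (hs0 : s ≠ 0)
    (h : ∀ k : ℤ, 1 - -s ^ 2 * (p ^ 2) ^ k ≠ 0) (Q : ℂ[X]) :
    Summable (hermiteIITerm p s Q) := by
  refine ((summable_zpow_mul_eval hp hp0 hs0 h Q s).add
    (summable_zpow_mul_eval hp hp0 hs0 h Q (-s))).congr fun k => ?_
  rw [hermiteIITerm, mul_add, add_div, neg_mul s]

theorem exists_eval_sub_eval_neg (F : ℂ[X]) :
    ∃ R : ℂ[X], ∀ x, F.eval x - F.eval (-x) = x * R.eval x := by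
  obtain ⟨R, hR⟩ : X ∣ F - F.comp (-X) := by
    rw [X_dvd_iff, coeff_zero_eq_eval_zero]
    simp
  refine ⟨R, fun x => ?_⟩
  simpa using congrArg (eval x) hR

/-- Summation by parts: multiplication by the raised polynomial is adjoint to the forward shift. -/
theorem tsum_hermiteIITerm_mul_succ (hp : ‖p‖ < 1) (hp0 : p ≠ 0) (hs0 : s ≠ 0)
    (h : ∀ k : ℤ, 1 - -s ^ 2 * (p ^ 2) ^ k ≠ 0) (n : ℕ) (G D : ℂ[X]) (d : ℂ)
    (hGD : ∀ x, x ≠ 0 → G.eval (x / p) - G.eval x = d * (x * D.eval x)) :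
    ∑' k, hermiteIITerm p s (G * hermiteIIPoly p (n + 1)) k =
      p ^ (-(n : ℤ)) * d * ∑' k, hermiteIITerm p s (D * hermiteIIPoly p n) k := by
  set F : ℂ[X] := G.comp (C p⁻¹ * X) * hermiteIIPoly p n with hF
  have hFe (x : ℂ) : F.eval x = G.eval (x / p) * (hermiteIIPoly p n).eval x := by
    simp [hF, div_eq_inv_mul]
  set T : ℤ → ℂ := fun k => (F.eval (s * p ^ k) - F.eval (-(s * p ^ k))) /
    qPochInf (-s ^ 2 * (p ^ 2) ^ k) (p ^ 2) with hT
  have hTs : Summable T := by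
    obtain ⟨R, hR⟩ := exists_eval_sub_eval_neg F
    refine ((summable_zpow_mul_eval hp hp0 hs0 h R s).mul_left s).congr fun k => ?_
    simp only [hT, hR]
    ring
  have hTs' : Summable fun k : ℤ => T (k + 1) := (Equiv.addRight (1 : ℤ)).summable_iff.mpr hTs
  have hT0 : ∑' k : ℤ, (T (k + 1) - T k) = 0 := by
    rw [hTs'.tsum_sub hTs, sub_eq_zero]
    exact (Equiv.addRight (1 : ℤ)).tsum_eq T
  have key (k : ℤ) : hermiteIITerm p s (G * hermiteIIPoly p (n + 1)) k =
      p ^ (-(n : ℤ)) * d * hermiteIITerm p s (D * hermiteIIPoly p n) k +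
        p ^ (-(n : ℤ)) / s * (T (k + 1) - T k) := by
    have hx : s * p ^ k ≠ 0 := mul_ne_zero hs0 (zpow_ne_zero _ hp0)
    have hP := norm_sq_lt_one hp
    have hP0 := pow_ne_zero 2 hp0
    have w0 := qPochInf_mul_zpow_ne_zero hP hP0 h (k + 1)
    have w1 := qPochInf_mul_zpow_succ (a := -s ^ 2) hP hP0 k
    have w2 := h k
    have hsq : 1 - -s ^ 2 * (p ^ 2) ^ k = 1 + (s * p ^ k) ^ 2 := by
      rw [mul_pow, ← zpow_natCast p 2, ← zpow_natCast (p ^ k) 2, zpow_comm]; ring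
    have hnext : s * p ^ (k + 1) = p * (s * p ^ k) := by rw [zpow_add_one₀ hp0]; ring
    have r1 := hermiteIIPoly_raise hp hp0 n hx
    have r2 := hermiteIIPoly_raise hp hp0 n (neg_ne_zero.mpr hx)
    have g1 := hGD _ hx
    have g2 := hGD _ (neg_ne_zero.mpr hx)
    simp only [hermiteIITerm, hT, w1, hFe, hnext, eval_mul, ← mul_neg p,
      mul_div_cancel_left₀ _ hp0]
    rw [hsq] at w2 ⊢
    obtain ⟨x, hxk⟩ : ∃ x, x = s * p ^ k := ⟨_, rfl⟩
    have hpk : p ^ k = x / s := (by rw [hxk]; field_simp)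
    rw [← hxk] at hx r1 r2 g1 g2 w2 ⊢
    rw [hpk]
    generalize qPochInf (-s ^ 2 * (p ^ 2) ^ (k + 1)) (p ^ 2) = w at w0 ⊢
    generalize (hermiteIIPoly p (n + 1)).eval x = a₁ at *
    generalize (hermiteIIPoly p (n + 1)).eval (-x) = a₂ at *
    generalize (hermiteIIPoly p n).eval x = b₁ at *
    generalize (hermiteIIPoly p n).eval (-x) = b₂ at *
    generalize (hermiteIIPoly p n).eval (p * x) = c₁ at *
    generalize (hermiteIIPoly p n).eval (p * -x) = c₂ at *
    generalize G.eval (x / p) = u₁ at *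
    generalize G.eval (-x / p) = u₂ at *
    generalize G.eval x = v₁ at *
    generalize G.eval (-x) = v₂ at *
    generalize D.eval x = d₁ at *
    generalize D.eval (-x) = d₂ at *
    generalize p ^ (-(n : ℤ)) = y at *
    field_simp
    linear_combination v₁ * r1 - v₂ * r2 + y * b₁ * g1 - y * b₂ * g2
  rw [tsum_congr key, ((summable_hermiteIITerm hp hp0 hs0 h _).mul_left _).tsum_add
    ((hTs'.sub hTs).mul_left _), tsum_mul_left, tsum_mul_left, hT0, mul_zero, add_zero]

theorem tsum_hermiteIITerm_succ_mul_succ (hp : ‖p‖ < 1) (hp0 : p ≠ 0) (hs0 : s ≠ 0)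
    (h : ∀ k : ℤ, 1 - -s ^ 2 * (p ^ 2) ^ k ≠ 0) (m n : ℕ) :
    ∑' k, hermiteIITerm p s (hermiteIIPoly p (m + 1) * hermiteIIPoly p (n + 1)) k =
      p ^ (-(n : ℤ)) * (p ^ (-((m + 1 : ℕ) : ℤ)) - 1) *
        ∑' k, hermiteIITerm p s (hermiteIIPoly p m * hermiteIIPoly p n) k :=
  tsum_hermiteIITerm_mul_succ hp hp0 hs0 h n _ _ _ fun _ hx => hermiteIIPoly_lower hp0 m hx

theorem tsum_hermiteIITerm_zero_mul_succ (hp : ‖p‖ < 1) (hp0 : p ≠ 0) (hs0 : s ≠ 0)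
    (h : ∀ k : ℤ, 1 - -s ^ 2 * (p ^ 2) ^ k ≠ 0) (n : ℕ) :
    ∑' k, hermiteIITerm p s (hermiteIIPoly p 0 * hermiteIIPoly p (n + 1)) k = 0 := by
  rw [tsum_hermiteIITerm_mul_succ hp hp0 hs0 h n _ 0 0 (by simp [hermiteIIPoly_zero])]
  simp

theorem tsum_hermiteIITerm_of_ne (hp : ‖p‖ < 1) (hp0 : p ≠ 0) (hs0 : s ≠ 0)
    (h : ∀ k : ℤ, 1 - -s ^ 2 * (p ^ 2) ^ k ≠ 0) {m n : ℕ} (hmn : m ≠ n) :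
    ∑' k, hermiteIITerm p s (hermiteIIPoly p m * hermiteIIPoly p n) k = 0 := by
  induction m generalizing n with
  | zero =>
    obtain ⟨n, rfl⟩ := Nat.exists_eq_succ_of_ne_zero hmn.symm
    exact tsum_hermiteIITerm_zero_mul_succ hp hp0 hs0 h n
  | succ m ih =>
    cases n with
    | zero => rw [mul_comm]; exact tsum_hermiteIITerm_zero_mul_succ hp hp0 hs0 h m
    | succ n =>
      rw [tsum_hermiteIITerm_succ_mul_succ hp hp0 hs0 h, ih (by omega), mul_zero]

theorem tsum_hermiteIITerm_self (hp : ‖p‖ < 1) (hp0 : p ≠ 0) (hs0 : s ≠ 0)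
    (h : ∀ k : ℤ, 1 - -s ^ 2 * (p ^ 2) ^ k ≠ 0) (n : ℕ) :
    ∑' k, hermiteIITerm p s (hermiteIIPoly p n * hermiteIIPoly p n) k =
      p ^ (-(n : ℤ) ^ 2) * qPoch p p n * ∑' k, hermiteIITerm p s 1 k := by
  induction n with
  | zero => simp [hermiteIIPoly_zero, qPoch]
  | succ n ih =>
    have e : p ^ (-((n + 1 : ℕ) : ℤ) ^ 2) =
        p ^ (-(n : ℤ) ^ 2) * p ^ (-(n : ℤ)) * (p ^ n)⁻¹ * p⁻¹ := by
      rw [← zpow_natCast p n, ← zpow_neg, ← zpow_add₀ hp0, ← zpow_add₀ hp0, ← zpow_sub_one₀ hp0]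
      congr 1
      push_cast
      ring
    have hpn : p ^ n ≠ 0 := pow_ne_zero _ hp0
    rw [tsum_hermiteIITerm_succ_mul_succ hp hp0 hs0 h, ih, qPoch_succ, e, zpow_neg p ((n + 1 : ℕ) : ℤ),
      zpow_natCast, pow_succ]
    field_simp

theorem tsum_hermiteIITerm_one (hp : ‖p‖ < 1) (hp0 : p ≠ 0) (hs0 : s ≠ 0)
    (h : ∀ k : ℤ, 1 - -s ^ 2 * (p ^ 2) ^ k ≠ 0) :
    ∑' k, hermiteIITerm p s 1 k =
      2 * (qPochInf (p ^ 2) (p ^ 2) * qPochInf (-s ^ 2 * p) (p ^ 2) *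
          qPochInf (p ^ 2 / (-s ^ 2 * p)) (p ^ 2) /
        (qPochInf p (p ^ 2) * qPochInf (-s ^ 2) (p ^ 2) * qPochInf (p ^ 2 / -s ^ 2) (p ^ 2))) := by
  rw [← tsum_zpow_div_qPochInf (norm_sq_lt_one hp) (pow_ne_zero 2 hp0)
    (neg_ne_zero.mpr (pow_ne_zero 2 hs0)) h hp hp0, ← tsum_mul_left]
  refine tsum_congr fun k => ?_
  rw [hermiteIITerm, eval_one, eval_one]
  ring

end Orthogonality

theorem qHermiteII_eq_eval {q : ℝ} (hq : q ≠ 0) (m : ℕ) {x : ℂ} (hx : x ≠ 0) :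
    qHermiteII q m x = (hermiteIIPoly ((q : ℂ) ^ (-2 : ℤ)) m).eval x := by
  have hqc : (q : ℂ) ≠ 0 := by exact_mod_cast hq
  have hp0 : (q : ℂ) ^ (-2 : ℤ) ≠ 0 := zpow_ne_zero _ hqc
  have hP : (q : ℂ) ^ (-4 : ℤ) = ((q : ℂ) ^ (-2 : ℤ)) ^ 2 := by
    rw [← zpow_natCast, ← zpow_mul]; norm_num
  have hy : (q : ℂ) ^ (2 * (m : ℤ)) = ((q : ℂ) ^ (-2 : ℤ)) ^ (-(m : ℤ)) := by
    rw [← zpow_mul]; congr 1; ring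
  have hy' : (q : ℂ) ^ (2 * (m : ℤ) - 2) =
      ((q : ℂ) ^ (-2 : ℤ)) ^ (-(m : ℤ)) * (q : ℂ) ^ (-2 : ℤ) := by
    rw [← hy, ← zpow_add₀ hqc]; congr 1
  have hterm (j : ℕ) : x ^ m * (qPoch ((q : ℂ) ^ (2 * (m : ℤ) - 2)) ((q : ℂ) ^ (-4 : ℤ)) j *
        qPoch ((q : ℂ) ^ (2 * (m : ℤ))) ((q : ℂ) ^ (-4 : ℤ)) j /
        qPoch ((q : ℂ) ^ (-4 : ℤ)) ((q : ℂ) ^ (-4 : ℤ)) j *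
        (-(q : ℂ) ^ (-4 : ℤ) / x ^ 2) ^ j) =
      hermiteIICoeff ((q : ℂ) ^ (-2 : ℤ)) (((q : ℂ) ^ (-2 : ℤ)) ^ (-(m : ℤ))) j *
        x ^ ((m : ℤ) - 2 * j) := by
    rw [hermiteIICoeff, hy, hy', hP, div_pow, zpow_sub₀ hx, zpow_mul, zpow_natCast, zpow_natCast,
      zpow_ofNat]
    ring
  rw [qHermiteII, phi21, ← tsum_mul_left, tsum_congr hterm,
    eval_hermiteIIPoly hp0 (Nat.lt_succ_self m), tsum_eq_sum]
  intro j hj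
  rw [hermiteIICoeff_eq_zero hp0 (by simp at hj; omega), zero_mul]

theorem hasSum_prod_intUnits {f : ℤ × ℤˣ → ℂ} (h1 : Summable fun k => f (k, 1))
    (h2 : Summable fun k => f (k, -1)) :
    Summable f ∧ ∑' x, f x = ∑' k, (f (k, 1) + f (k, -1)) := by
  have hu (g : ℤˣ → ℝ) : ∑' σ, g σ = g 1 + g (-1) := by
    rw [tsum_fintype]; exact Finset.sum_pair (by decide)
  have hu' (g : ℤˣ → ℂ) : ∑' σ, g σ = g 1 + g (-1) := by
    rw [tsum_fintype]; exact Finset.sum_pair (by decide)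
  have hs : Summable f := by
    refine Summable.of_norm ((summable_prod_of_nonneg fun _ => norm_nonneg _).mpr
      ⟨fun k => Summable.of_finite, ?_⟩)
    simp only [hu]
    exact h1.norm.add h2.norm
  exact ⟨hs, by rw [hs.tsum_prod]; simp only [hu']⟩

/-- The orthogonality relation of the q-Hermite II polynomials on the q-lattice
`{σ √c q^{-2k} : k ∈ ℤ, σ = ±1}` (the sign `σ` ranges over `ℤˣ = {1, -1}`):
`∑_{k∈ℤ, σ=±1} h̃_m(σ√c q^{-2k}) h̃_n(σ√c q^{-2k}) q^{-2k} / (-c q^{-4k};q⁻⁴)_∞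
  = 2 δ_{mn} q^{2m²} (q⁻²;q⁻²)_m
      (q⁻⁴;q⁻⁴)_∞ (-cq⁻²;q⁻⁴)_∞ (-c⁻¹q⁻²;q⁻⁴)_∞
      / ((q⁻²;q⁻⁴)_∞ (-c;q⁻⁴)_∞ (-c⁻¹q⁻⁴;q⁻⁴)_∞)`,
the family being summable. -/
theorem qHermiteII_orthogonality (q c : ℝ) (hq : 1 < q) (hc : 0 < c) (m n : ℕ) :
    Summable (fun kσ : ℤ × ℤˣ =>
      qHermiteII q m (((((kσ.2 : ℤ) : ℝ) * Real.sqrt c * q ^ (-2 * kσ.1) : ℝ) : ℂ)) *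
        qHermiteII q n (((((kσ.2 : ℤ) : ℝ) * Real.sqrt c * q ^ (-2 * kσ.1) : ℝ) : ℂ)) *
        (q : ℂ) ^ (-2 * kσ.1) /
        qPochInf (-(c : ℂ) * (q : ℂ) ^ (-4 * kσ.1)) ((q : ℂ) ^ (-4 : ℤ))) ∧
    ∑' kσ : ℤ × ℤˣ,
        qHermiteII q m (((((kσ.2 : ℤ) : ℝ) * Real.sqrt c * q ^ (-2 * kσ.1) : ℝ) : ℂ)) *
          qHermiteII q n (((((kσ.2 : ℤ) : ℝ) * Real.sqrt c * q ^ (-2 * kσ.1) : ℝ) : ℂ)) *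
          (q : ℂ) ^ (-2 * kσ.1) /
          qPochInf (-(c : ℂ) * (q : ℂ) ^ (-4 * kσ.1)) ((q : ℂ) ^ (-4 : ℤ)) =
      2 * (if m = n then 1 else 0) * (q : ℂ) ^ (2 * (m : ℤ) ^ 2) *
        qPoch ((q : ℂ) ^ (-2 : ℤ)) ((q : ℂ) ^ (-2 : ℤ)) m *
        (qPochInf ((q : ℂ) ^ (-4 : ℤ)) ((q : ℂ) ^ (-4 : ℤ)) *
          qPochInf (-(c : ℂ) * (q : ℂ) ^ (-2 : ℤ)) ((q : ℂ) ^ (-4 : ℤ)) *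
          qPochInf (-(c : ℂ)⁻¹ * (q : ℂ) ^ (-2 : ℤ)) ((q : ℂ) ^ (-4 : ℤ))) /
        (qPochInf ((q : ℂ) ^ (-2 : ℤ)) ((q : ℂ) ^ (-4 : ℤ)) *
          qPochInf (-(c : ℂ)) ((q : ℂ) ^ (-4 : ℤ)) *
          qPochInf (-(c : ℂ)⁻¹ * (q : ℂ) ^ (-4 : ℤ)) ((q : ℂ) ^ (-4 : ℤ))) := by
  obtain ⟨p, hpdef⟩ : ∃ p : ℂ, p = (q : ℂ) ^ (-2 : ℤ) := ⟨_, rfl⟩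
  obtain ⟨s, hsdef⟩ : ∃ s : ℂ, s = (Real.sqrt c : ℂ) := ⟨_, rfl⟩
  have hq0 : q ≠ 0 := by positivity
  have hqc : (q : ℂ) ≠ 0 := by exact_mod_cast hq0
  have hcc : (c : ℂ) ≠ 0 := by exact_mod_cast hc.ne'
  have hp0 : p ≠ 0 := hpdef ▸ zpow_ne_zero _ hqc
  have hp : ‖p‖ < 1 := by
    rw [hpdef, norm_zpow, Complex.norm_real, Real.norm_of_nonneg (by positivity)]
    exact zpow_lt_one_of_neg₀ hq (by norm_num)
  have hs2 : s ^ 2 = c := by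
    rw [hsdef]; exact_mod_cast Real.sq_sqrt hc.le
  have hs0 : s ≠ 0 := by
    rintro rfl
    exact hcc (by rw [← hs2]; simp)
  have hpk (k : ℤ) : (q : ℂ) ^ (-2 * k) = p ^ k := by rw [hpdef, ← zpow_mul]
  have hP : (q : ℂ) ^ (-4 : ℤ) = p ^ 2 := by
    rw [hpdef, ← zpow_natCast, ← zpow_mul]; norm_num
  have hPk (k : ℤ) : (q : ℂ) ^ (-4 * k) = (p ^ 2) ^ k := by rw [← hP, ← zpow_mul]
  have h (k : ℤ) : 1 - -s ^ 2 * (p ^ 2) ^ k ≠ 0 := by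
    rw [hs2, ← hPk]
    have : (0 : ℝ) < 1 - -c * q ^ (-4 * k) := by
      have : 0 < c * q ^ (-4 * k) := by positivity
      linarith
    exact_mod_cast this.ne'
  have hx (k : ℤ) : s * p ^ k ≠ 0 := mul_ne_zero hs0 (zpow_ne_zero _ hp0)
  have e1 (k : ℤ) (j : ℕ) :
      qHermiteII q j (((((1 : ℤˣ) : ℤ) : ℝ) * Real.sqrt c * q ^ (-2 * k) : ℝ) : ℂ) =
        (hermiteIIPoly p j).eval (s * p ^ k) := by
    have : ((((((1 : ℤˣ) : ℤ) : ℝ) * Real.sqrt c * q ^ (-2 * k) : ℝ)) : ℂ) = s * p ^ k := by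
      rw [← hpk, hsdef]; push_cast; ring
    rw [this, qHermiteII_eq_eval hq0 j (hx k), hpdef]
  have e2 (k : ℤ) (j : ℕ) :
      qHermiteII q j (((((-1 : ℤˣ) : ℤ) : ℝ) * Real.sqrt c * q ^ (-2 * k) : ℝ) : ℂ) =
        (hermiteIIPoly p j).eval (-(s * p ^ k)) := by
    have : ((((((-1 : ℤˣ) : ℤ) : ℝ) * Real.sqrt c * q ^ (-2 * k) : ℝ)) : ℂ) = -(s * p ^ k) := by
      rw [← hpk, hsdef]; push_cast; ring
    rw [this, qHermiteII_eq_eval hq0 j (neg_ne_zero.mpr (hx k)), hpdef]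
  have s1 := summable_zpow_mul_eval hp hp0 hs0 h (hermiteIIPoly p m * hermiteIIPoly p n) s
  have s2 := summable_zpow_mul_eval hp hp0 hs0 h (hermiteIIPoly p m * hermiteIIPoly p n) (-s)
  obtain ⟨hsum, hval⟩ := hasSum_prod_intUnits (f := fun kσ : ℤ × ℤˣ =>
      qHermiteII q m (((((kσ.2 : ℤ) : ℝ) * Real.sqrt c * q ^ (-2 * kσ.1) : ℝ) : ℂ)) *
        qHermiteII q n (((((kσ.2 : ℤ) : ℝ) * Real.sqrt c * q ^ (-2 * kσ.1) : ℝ) : ℂ)) *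
        (q : ℂ) ^ (-2 * kσ.1) /
        qPochInf (-(c : ℂ) * (q : ℂ) ^ (-4 * kσ.1)) ((q : ℂ) ^ (-4 : ℤ)))
    (s1.congr fun k => by
      simp only [e1, hpk, hPk, hP, hs2, Polynomial.eval_mul]; ring)
    (s2.congr fun k => by
      simp only [e2, hpk, hPk, hP, hs2, Polynomial.eval_mul, neg_mul s]; ring)
  refine ⟨hsum, hval.trans ?_⟩
  have hterm : ∑' k, hermiteIITerm p s (hermiteIIPoly p m * hermiteIIPoly p n) k =
      2 * (if m = n then 1 else 0) * p ^ (-(m : ℤ) ^ 2) * qPoch p p m *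
        (qPochInf (p ^ 2) (p ^ 2) * qPochInf (-s ^ 2 * p) (p ^ 2) *
          qPochInf (p ^ 2 / (-s ^ 2 * p)) (p ^ 2)) /
        (qPochInf p (p ^ 2) * qPochInf (-s ^ 2) (p ^ 2) * qPochInf (p ^ 2 / -s ^ 2) (p ^ 2)) := by
    rcases eq_or_ne m n with rfl | hmn
    · rw [tsum_hermiteIITerm_self hp hp0 hs0 h, tsum_hermiteIITerm_one hp hp0 hs0 h, if_pos rfl]
      ring
    · rw [tsum_hermiteIITerm_of_ne hp hp0 hs0 h hmn, if_neg hmn]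
      simp
  have a1 : p ^ 2 / (-(c : ℂ) * p) = -(c : ℂ)⁻¹ * p := by field_simp
  have a2 : p ^ 2 / -(c : ℂ) = -(c : ℂ)⁻¹ * p ^ 2 := by field_simp
  have a3 : (q : ℂ) ^ (2 * (m : ℤ) ^ 2) = p ^ (-(m : ℤ) ^ 2) := by
    rw [hpdef, ← zpow_mul]; congr 1; ring
  rw [hs2, a1, a2] at hterm
  rw [a3, hP, ← hpdef, ← hterm]
  refine tsum_congr fun k => ?_
  simp only [e1, e2, hpk, hPk, hermiteIITerm, hs2, Polynomial.eval_mul]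
  ring
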